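/- arXiv:2507.12121 — 3 statements merged into one kernel-verified Lean document; each statement's English description precedes it below -/
import Mathlib

section
/- Let m ≥ 1 with gcd(m, 6) = 1 and let π = (ℤ/mℤ) × T*, where T* is the binary tetrahedral group of order 24. Then dim_ℂ 𝒜_Θ^odd(ℂπ) = (19/3)m² + 6m + 8/3 and dim_ℂ 𝒜_Θ^odd(Ker ε) = (19/3)m² + (5/2)m + 7/6. -/
/-!
Statement 5: dimensions of `𝒜_Θ^odd(ℂπ)` and `𝒜_Θ^odd(Ker ε)` for
`π = (ℤ/mℤ) × T*`, where `T*` is the binary tetrahedral group of order 24,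
realized as `SL(2, ℤ/3ℤ)`.

Identifying `(ℂπ)^{⊗3}` with functions `π³ → ℂ`, `dim 𝒜_Θ^odd(ℂπ)` (resp.
`dim 𝒜_Θ^odd(Ker ε)`) is the dimension of the space of functions `π³ → ℂ`
(resp. of such functions with vanishing marginal sums, cutting out `(Ker ε)^{⊗3}`)
invariant under permutations of the coordinates, the two-sided action
`(x,y,z) ↦ (gxh⁻¹,gyh⁻¹,gzh⁻¹)` and coordinatewise inversion.
-/

open scoped BigOperators

/-- The dimension `dim_ℂ 𝒜_Θ^odd(ℂπ)`. -/
noncomputable def dimAThetaOddGroupAlgebra (G : Type*) [Group G] : ℕ :=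
  Module.finrank ℂ ↥(Submodule.span ℂ
    { f : G × G × G → ℂ |
      (∀ x y z : G, f (y, x, z) = f (x, y, z)) ∧
      (∀ x y z : G, f (x, z, y) = f (x, y, z)) ∧
      (∀ g h x y z : G, f (g * x * h⁻¹, g * y * h⁻¹, g * z * h⁻¹) = f (x, y, z)) ∧
      (∀ x y z : G, f (x⁻¹, y⁻¹, z⁻¹) = f (x, y, z)) })

/-- The dimension `dim_ℂ 𝒜_Θ^odd(Ker ε)`. -/
noncomputable def dimAThetaOddKerAug (G : Type*) [Group G] : ℕ :=
  Module.finrank ℂ ↥(Submodule.span ℂ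
    { f : G × G × G → ℂ |
      (∀ x y z : G, f (y, x, z) = f (x, y, z)) ∧
      (∀ x y z : G, f (x, z, y) = f (x, y, z)) ∧
      (∀ g h x y z : G, f (g * x * h⁻¹, g * y * h⁻¹, g * z * h⁻¹) = f (x, y, z)) ∧
      (∀ x y z : G, f (x⁻¹, y⁻¹, z⁻¹) = f (x, y, z)) ∧
      (∀ y z : G, ∑ᶠ x : G, f (x, y, z) = 0) ∧
      (∀ x z : G, ∑ᶠ y : G, f (x, y, z) = 0) ∧
      (∀ x y : G, ∑ᶠ z : G, f (x, y, z) = 0) })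

/-- The binary tetrahedral group `T*` of order 24, realized as `SL(2, ℤ/3ℤ)`. -/
abbrev binaryTetrahedralGroup : Type :=
  Matrix.SpecialLinearGroup (Fin 2) (ZMod 3)

open Finset

/-- If the maps `ρ i` fix every function of `V` and averaging over them lands in `V`, then the
dimension of `V` is the mean number of fixed points of the `ρ i`. -/
theorem card_mul_finrank_eq_sum_card_fixed {ι X : Type*} [Fintype ι] [Nonempty ι] [Fintype X]
    [DecidableEq X] (ρ : ι → X → X) (V : Submodule ℂ (X → ℂ))
    (hfix : ∀ φ ∈ V, ∀ i x, φ (ρ i x) = φ x)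
    (havg : ∀ φ : X → ℂ, (fun x => ∑ i, φ (ρ i x)) ∈ V) :
    Fintype.card ι * Module.finrank ℂ V = ∑ i, #{x | ρ i x = x} := by
  have hι : (Fintype.card ι : ℂ) ≠ 0 := by simp
  have hproj : LinearMap.IsProj V
      ((Fintype.card ι : ℂ)⁻¹ • ∑ i, LinearMap.funLeft ℂ ℂ (ρ i)) := by
    constructor
    · intro φ
      convert V.smul_mem (Fintype.card ι : ℂ)⁻¹ (havg φ) using 1
      ext x
      simp [LinearMap.funLeft]
    · intro φ hφ
      ext x
      simp [LinearMap.funLeft, hfix φ hφ]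
  have htrace (i : ι) :
      LinearMap.trace ℂ _ (LinearMap.funLeft ℂ ℂ (ρ i)) = (#{x | ρ i x = x} : ℂ) := by
    rw [LinearMap.trace_eq_matrix_trace ℂ (Pi.basisFun ℂ X)]
    simp [Matrix.trace, LinearMap.funLeft, Pi.single_apply]
  have h := hproj.trace
  rw [map_smul, map_sum, smul_eq_mul, inv_mul_eq_iff_eq_mul₀ hι] at h
  simp only [htrace] at h
  exact_mod_cast h.symm

theorem sum_card_filter_eq_card_filter_prod {S X : Type*} [Fintype S] [Fintype X]
    (p : S → X → Prop) [∀ s, DecidablePred (p s)] :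
    ∑ s, #{x | p s x} = #{q : S × X | p q.1 q.2} := by
  simp only [Finset.card_filter, Fintype.sum_prod_type]

section Group

variable (G : Type*) [Group G]

/-- Functions of `(a, b) = (x⁻¹y, x⁻¹z)` that come from functions of `(x, y, z)` invariant under
permutations, two-sided translation and inversion. -/
def pairInvariants : Submodule ℂ (G × G → ℂ) where
  carrier := {φ | (∀ t a b, φ (t * a * t⁻¹, t * b * t⁻¹) = φ (a, b)) ∧
    (∀ a b, φ (b, a) = φ (a, b)) ∧ (∀ a b, φ (a⁻¹, a⁻¹ * b) = φ (a, b)) ∧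
    (∀ a b, φ (a⁻¹, b⁻¹) = φ (a, b))}
  add_mem' := by
    rintro φ ψ ⟨h₁, h₂, h₃, h₄⟩ ⟨k₁, k₂, k₃, k₄⟩
    simp_all
  zero_mem' := by simp
  smul_mem' := by
    rintro c φ ⟨h₁, h₂, h₃, h₄⟩
    simp_all

/-- Class functions on `G` that are invariant under inversion. -/
def realClassFunctions : Submodule ℂ (G → ℂ) where
  carrier := {ψ | (∀ t a, ψ (t * a * t⁻¹) = ψ a) ∧ ∀ a, ψ a⁻¹ = ψ a}
  add_mem' := by
    rintro φ ψ ⟨h₁, h₂⟩ ⟨k₁, k₂⟩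
    simp_all
  zero_mem' := by simp
  smul_mem' := by
    rintro c φ ⟨h₁, h₂⟩
    simp_all

variable {G}

/-- The function `(x, y, z) ↦ φ (x⁻¹y, x⁻¹z)`, as a linear map in `φ`. -/
def leftInvariantExtension : (G × G → ℂ) →ₗ[ℂ] (G × G × G → ℂ) :=
  LinearMap.funLeft ℂ ℂ fun p => (p.1⁻¹ * p.2.1, p.1⁻¹ * p.2.2)

theorem leftInvariantExtension_apply (φ : G × G → ℂ) (x y z : G) :
    leftInvariantExtension φ (x, y, z) = φ (x⁻¹ * y, x⁻¹ * z) := rfl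

theorem leftInvariantExtension_injective :
    Function.Injective (leftInvariantExtension (G := G)) := by
  intro φ ψ h
  ext ⟨a, b⟩
  simpa [leftInvariantExtension_apply] using congrFun h (1, a, b)

theorem finrank_span_eq_of_image_eq {S : Set (G × G × G → ℂ)} {V : Submodule ℂ (G × G → ℂ)}
    (h : leftInvariantExtension '' (V : Set (G × G → ℂ)) = S) :
    Module.finrank ℂ (Submodule.span ℂ S) = Module.finrank ℂ V := by
  rw [← h, ← Submodule.map_coe, Submodule.span_eq]
  exact (Submodule.equivMapOfInjective _ leftInvariantExtension_injective V).finrank_eq.symm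

theorem eq_leftInvariantExtension {f : G × G × G → ℂ}
    (hf : ∀ g h x y z : G, f (g * x * h⁻¹, g * y * h⁻¹, g * z * h⁻¹) = f (x, y, z)) :
    leftInvariantExtension (fun p => f (1, p)) = f := by
  ext ⟨x, y, z⟩
  simpa [leftInvariantExtension_apply] using hf x⁻¹ 1 x y z

theorem leftInvariantExtension_mem_iff (φ : G × G → ℂ) :
    φ ∈ pairInvariants G ↔
      (∀ x y z, leftInvariantExtension φ (y, x, z) = leftInvariantExtension φ (x, y, z)) ∧
      (∀ x y z, leftInvariantExtension φ (x, z, y) = leftInvariantExtension φ (x, y, z)) ∧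
      (∀ g h x y z, leftInvariantExtension φ (g * x * h⁻¹, g * y * h⁻¹, g * z * h⁻¹) =
        leftInvariantExtension φ (x, y, z)) ∧
      (∀ x y z, leftInvariantExtension φ (x⁻¹, y⁻¹, z⁻¹) =
        leftInvariantExtension φ (x, y, z)) := by
  simp only [leftInvariantExtension_apply]
  constructor
  · rintro ⟨h₁, h₂, h₃, h₄⟩
    refine ⟨fun x y z => ?_, fun x y z => h₂ _ _, fun g h x y z => ?_, fun x y z => ?_⟩
    · simpa [mul_assoc] using h₃ (x⁻¹ * y) (x⁻¹ * z)
    · simpa [mul_assoc] using h₁ h (x⁻¹ * y) (x⁻¹ * z)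
    · rw [← h₄ (x⁻¹ * y), ← h₁ x⁻¹ (x⁻¹⁻¹ * y⁻¹)]
      simp
  · rintro ⟨h₁, h₂, h₃, h₄⟩
    refine ⟨fun t a b => ?_, fun a b => ?_, fun a b => ?_, fun a b => ?_⟩
    · simpa using h₃ t t 1 a b
    · simpa using h₂ 1 a b
    · simpa using h₁ 1 a b
    · simpa using h₄ 1 a b

theorem dimAThetaOddGroupAlgebra_eq_finrank :
    dimAThetaOddGroupAlgebra G = Module.finrank ℂ (pairInvariants G) := by
  refine finrank_span_eq_of_image_eq (Set.ext fun f => ⟨?_, fun hf => ?_⟩)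
  · rintro ⟨φ, hφ, rfl⟩
    exact (leftInvariantExtension_mem_iff φ).1 hφ
  · have h := eq_leftInvariantExtension hf.2.2.1
    refine ⟨_, (leftInvariantExtension_mem_iff _).2 ?_, h⟩
    rwa [h]

section Fintype

variable [Fintype G]

/-- Summation over the last variable. -/
def marginal : (G × G → ℂ) →ₗ[ℂ] (G → ℂ) where
  toFun φ a := ∑ b, φ (a, b)
  map_add' φ ψ := by ext; simp [Finset.sum_add_distrib]
  map_smul' c φ := by ext; simp [Finset.mul_sum]

omit [Group G] in
theorem marginal_apply (φ : G × G → ℂ) (a : G) : marginal φ a = ∑ b, φ (a, b) := rfl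

theorem sum_leftInvariantExtension (φ : G × G → ℂ) (x y : G) :
    ∑ z, leftInvariantExtension φ (x, y, z) = marginal φ (x⁻¹ * y) :=
  Equiv.sum_comp (Equiv.mulLeft x⁻¹) fun b => φ (x⁻¹ * y, b)

theorem dimAThetaOddKerAug_eq_finrank :
    dimAThetaOddKerAug G =
      Module.finrank ℂ ↥(pairInvariants G ⊓ LinearMap.ker (marginal (G := G))) := by
  refine finrank_span_eq_of_image_eq (Set.ext fun f => ⟨?_, fun hf => ?_⟩)
  · rintro ⟨φ, ⟨hφ, hφ₀⟩, rfl⟩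
    obtain ⟨h₁, h₂, h₃, h₄⟩ := (leftInvariantExtension_mem_iff φ).1 hφ
    have h₅ (x y : G) : ∑ᶠ z, leftInvariantExtension φ (x, y, z) = 0 := by
      rw [finsum_eq_sum_of_fintype, sum_leftInvariantExtension, LinearMap.mem_ker.1 hφ₀]
      rfl
    refine ⟨h₁, h₂, h₃, h₄, fun y z => ?_, fun x z => ?_, h₅⟩
    · rw [← h₅ y z]
      exact finsum_congr fun x => by rw [h₂ y x z, h₁]
    · rw [← h₅ x z]
      exact finsum_congr fun y => by rw [h₂]
  · obtain ⟨h₁, h₂, h₃, h₄, -, -, h₅⟩ := hf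
    have h := eq_leftInvariantExtension h₃
    refine ⟨_, ⟨(leftInvariantExtension_mem_iff _).2 ?_, ?_⟩, h⟩
    · rw [h]
      exact ⟨h₁, h₂, h₃, h₄⟩
    · refine LinearMap.mem_ker.2 (funext fun a => ?_)
      exact (finsum_eq_sum_of_fintype _).symm.trans (h₅ 1 a)

theorem map_marginal_pairInvariants :
    (pairInvariants G).map marginal = realClassFunctions G := by
  ext ψ
  constructor
  · rintro ⟨φ, ⟨h₁, h₂, h₃, h₄⟩, rfl⟩
    refine ⟨fun t a => ?_, fun a => ?_⟩
    · exact (Fintype.sum_equiv (MulAut.conj t).toEquiv _ _ fun b => (h₁ t a b).symm).symm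
    · exact (Fintype.sum_equiv (Equiv.inv G) _ _ fun b => (h₄ a b).symm).symm
  · rintro ⟨h₁, h₂⟩
    have hn : (Fintype.card G : ℂ) ≠ 0 := by simp
    refine ⟨fun p => (Fintype.card G : ℂ)⁻¹ * (ψ p.1 + ψ p.2 + ψ (p.1⁻¹ * p.2)) -
      2 * (Fintype.card G : ℂ)⁻¹ ^ 2 * ∑ b, ψ b, ⟨?_, ?_, ?_, ?_⟩, ?_⟩
    · intro t a b
      have h := h₁ t (a⁻¹ * b)
      simp only [mul_assoc, mul_inv_rev, inv_inv, inv_mul_cancel_left] at h ⊢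
      simp only [← mul_assoc] at h ⊢
      rw [h₁, h₁, h]
    · intro a b
      have h : ψ (b⁻¹ * a) = ψ (a⁻¹ * b) := by rw [← h₂]; simp
      simp only [h]
      ring
    · intro a b
      simp only [h₂, inv_inv, mul_inv_cancel_left]
      ring
    · intro a b
      have h : ψ (a * b⁻¹) = ψ (a⁻¹ * b) := by
        rw [← h₂ (a⁻¹ * b), ← h₁ a (a⁻¹ * b)⁻¹]
        simp [mul_assoc]
      simp only [h₂, inv_inv, h]
    · ext a
      have h : ∑ b, ψ (a⁻¹ * b) = ∑ b, ψ b := Equiv.sum_comp (Equiv.mulLeft a⁻¹) ψ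
      simp only [marginal_apply, Finset.sum_sub_distrib, Finset.sum_add_distrib,
        ← Finset.mul_sum, h, Finset.sum_const, Finset.card_univ, nsmul_eq_mul]
      field_simp
      ring

theorem dimAThetaOddKerAug_add_finrank_realClassFunctions :
    dimAThetaOddKerAug G + Module.finrank ℂ (realClassFunctions G) =
      dimAThetaOddGroupAlgebra G := by
  rw [dimAThetaOddKerAug_eq_finrank, dimAThetaOddGroupAlgebra_eq_finrank,
    ← map_marginal_pairInvariants, ← LinearMap.range_domRestrict,
    ← (marginal.domRestrict (pairInvariants G)).finrank_range_add_finrank_ker, add_comm,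
    LinearMap.ker_domRestrict, (Submodule.equivSubtypeMap _ _).finrank_eq,
    Submodule.map_comap_subtype]

variable [DecidableEq G]

theorem two_mul_card_mul_finrank_realClassFunctions :
    2 * Fintype.card G * Module.finrank ℂ (realClassFunctions G) =
      #{q : G × G | q.1 * q.2 = q.2 * q.1} + #{q : G × G | q.1 = q.2 * q.1 * q.2} := by
  have h := card_mul_finrank_eq_sum_card_fixed
    (fun (i : Bool × G) a => i.2 * cond i.1 a⁻¹ a * i.2⁻¹) (realClassFunctions G) ?_ ?_
  · simp only [Fintype.card_prod, Fintype.card_bool, Fintype.sum_prod_type, Fintype.sum_bool,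
      cond_true, cond_false, mul_inv_eq_iff_eq_mul, mul_inv_eq_iff_eq_mul] at h
    rw [h, sum_card_filter_eq_card_filter_prod, sum_card_filter_eq_card_filter_prod, add_comm]
  · rintro φ ⟨h₁, h₂⟩ ⟨_ | _, t⟩ a
    · exact h₁ t a
    · exact (h₁ t a⁻¹).trans (h₂ a)
  · intro φ
    have hconj (u a : G) : ∑ t, φ (t * (u * a * u⁻¹) * t⁻¹) = ∑ t, φ (t * a * t⁻¹) :=
      Fintype.sum_equiv (Equiv.mulRight u) _ _ (by simp [mul_assoc])
    simp only [Fintype.sum_prod_type, Fintype.sum_bool, cond_true, cond_false]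
    refine ⟨fun u a => ?_, fun a => ?_⟩
    · simp only [hconj, conj_inv]
    · simp only [inv_inv, add_comm]

/-- The effect on `(x⁻¹y, x⁻¹z)` of the six permutations of `(x, y, z)`. -/
def permuteTriple (i : Fin 6) (p : G × G) : G × G :=
  ![(p.1, p.2), (p.2, p.1), (p.1⁻¹, p.1⁻¹ * p.2), (p.2⁻¹ * p.1, p.2⁻¹), (p.1⁻¹ * p.2, p.1⁻¹),
    (p.2⁻¹, p.2⁻¹ * p.1)] i

omit [Fintype G] [DecidableEq G] in
theorem permuteTriple_sum_mem (φ : G → G → ℂ)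
    (hφ : ∀ t a b, φ (t * a * t⁻¹) (t * b * t⁻¹) = φ a b) :
    (fun p : G × G => φ p.1⁻¹ p.2⁻¹ + φ p.2⁻¹ p.1⁻¹ + φ p.1 (p.1 * p.2⁻¹) +
      φ (p.2 * p.1⁻¹) p.2 + φ (p.1 * p.2⁻¹) p.1 + φ p.2 (p.2 * p.1⁻¹) +
      (φ p.1 p.2 + φ p.2 p.1 + φ p.1⁻¹ (p.1⁻¹ * p.2) +
      φ (p.2⁻¹ * p.1) p.2⁻¹ + φ (p.1⁻¹ * p.2) p.1⁻¹ + φ p.2⁻¹ (p.2⁻¹ * p.1))) ∈ pairInvariants G := by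
  refine ⟨fun t a b => ?_, fun a b => ?_, fun a b => ?_, fun a b => ?_⟩
  · have h (a b : G) : (t * a * t⁻¹) * (t * b * t⁻¹) = t * (a * b) * t⁻¹ := by group
    simp only [conj_inv, h, hφ]
  · ring
  · have h₁ := hφ a a (b⁻¹ * a)
    have h₂ := hφ a (b⁻¹ * a) a
    have h₃ := hφ a a⁻¹ (a⁻¹ * (b⁻¹ * a))
    have h₄ := hφ a (a⁻¹ * (b⁻¹ * a)) a⁻¹
    have h₅ := hφ a (a⁻¹ * b) (a⁻¹ * (b * a))
    have h₆ := hφ a (a⁻¹ * (b * a)) (a⁻¹ * b)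
    simp only [mul_assoc, mul_inv_rev, inv_inv, mul_inv_cancel, one_mul,
      mul_one, mul_inv_cancel_left] at h₁ h₂ h₃ h₄ h₅ h₆ ⊢
    rw [← h₁, ← h₂, ← h₃, ← h₄, ← h₅, ← h₆]
    ring
  · simp only [inv_inv]
    ring

theorem card_filter_graph {S X Y : Type*} [Fintype S] [Fintype X] [Fintype Y] [DecidableEq Y]
    (p : S → X → Prop) [∀ s, DecidablePred (p s)] (f : S → X → Y) :
    #{q : S × X × Y | p q.1 q.2.1 ∧ f q.1 q.2.1 = q.2.2} = #{q : S × X | p q.1 q.2} :=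
  Finset.card_nbij' (fun q => (q.1, q.2.1)) (fun q => (q.1, q.2, f q.1 q.2))
    (by rintro ⟨s, x, y⟩; simp +contextual) (by rintro ⟨s, x⟩; simp)
    (by rintro ⟨s, x, y⟩; simp) (by rintro ⟨s, x⟩; simp)

theorem card_filter_swap {S X : Type*} [Fintype S] [Fintype X] (p q : S → X → X → Prop)
    [∀ s x, DecidablePred (p s x)] [∀ s x, DecidablePred (q s x)] :
    #{x : S × X × X | p x.1 x.2.2 x.2.1 ∧ q x.1 x.2.2 x.2.1} =
      #{x : S × X × X | q x.1 x.2.1 x.2.2 ∧ p x.1 x.2.1 x.2.2} :=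
  Finset.card_equiv ((Equiv.refl S).prodCongr (Equiv.prodComm X X)) (by simp [and_comm])

theorem card_conj_swap :
    #{q : G × G × G | q.1 * q.2.2 * q.1⁻¹ = q.2.1 ∧ q.1 * q.2.1 * q.1⁻¹ = q.2.2} =
      #{q : G × G | q.1 ^ 2 * q.2 = q.2 * q.1 ^ 2} := by
  convert card_filter_graph (fun t a : G => t ^ 2 * a = a * t ^ 2) fun t a => t * a * t⁻¹ using 3
  refine and_congr_left fun h => ?_
  rw [← h]
  simp only [pow_two, mul_assoc]
  simp only [← mul_assoc, mul_inv_eq_iff_eq_mul]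

theorem card_conj_inv_swap :
    #{q : G × G × G | q.1 * q.2.2⁻¹ * q.1⁻¹ = q.2.1 ∧ q.1 * q.2.1⁻¹ * q.1⁻¹ = q.2.2} =
      #{q : G × G | q.1 ^ 2 * q.2 = q.2 * q.1 ^ 2} := by
  convert card_filter_graph (fun t a : G => t ^ 2 * a = a * t ^ 2) fun t a => t * a⁻¹ * t⁻¹ using 3
  refine and_congr_left fun h => ?_
  rw [← h]
  simp only [pow_two, mul_assoc, mul_inv_rev, inv_inv]
  simp only [← mul_assoc, mul_inv_eq_iff_eq_mul]

theorem card_conj_transpose :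
    #{q : G × G × G | q.1 * q.2.1⁻¹ * q.1⁻¹ = q.2.1 ∧
      q.1 * (q.2.1⁻¹ * q.2.2) * q.1⁻¹ = q.2.2} =
      #{q : G × G | q.1 ^ 2 * q.2 = q.2 * q.1 ^ 2} := by
  refine Finset.card_nbij' (fun q => (q.1, q.2.1⁻¹ * q.2.2))
    (fun q => (q.1, q.1 * q.2 * q.1⁻¹ * q.2⁻¹, q.1 * q.2 * q.1⁻¹)) ?_ ?_ ?_ ?_
  · rintro ⟨t, a, b⟩ h
    obtain ⟨d, rfl⟩ : ∃ d, b = a * d := ⟨a⁻¹ * b, by simp⟩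
    simp only [coe_filter, mem_univ, true_and, Set.mem_ofPred_eq, inv_mul_cancel_left] at h ⊢
    obtain ⟨h₁, h₂⟩ := h
    obtain rfl : a = t * d * t⁻¹ * d⁻¹ := eq_mul_inv_of_mul_eq h₂.symm
    have h := congrArg (d * t * d⁻¹ * t⁻¹ * · * t ^ 2 * d) h₁
    simpa [mul_assoc, pow_two, eq_comm] using h
  · rintro ⟨t, d⟩ h
    simp only [coe_filter, mem_univ, true_and, Set.mem_ofPred_eq] at h ⊢
    constructor
    · have h := congrArg (t * d * t⁻¹ * d⁻¹ * · * d⁻¹ * t⁻¹ * t⁻¹) h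
      simpa [mul_assoc, pow_two, eq_comm] using h
    · simp [mul_assoc]
  · rintro ⟨t, a, b⟩ h
    simp only [coe_filter, mem_univ, true_and, Set.mem_ofPred_eq] at h
    obtain ⟨h₁, h₂⟩ := h
    simp only [h₂, mul_inv_rev, inv_inv, mul_inv_cancel_left]
  · rintro ⟨t, d⟩ -
    simp [mul_assoc]

theorem card_conj_inv_transpose :
    #{q : G × G × G | q.1 * q.2.1 * q.1⁻¹ = q.2.1 ∧
      q.1 * (q.2.1 * q.2.2⁻¹) * q.1⁻¹ = q.2.2} =
      #{q : G × G | q.1 ^ 2 * q.2 = q.2 * q.1 ^ 2} := by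
  refine Finset.card_nbij' (fun q => (q.1 * q.2.2, q.1))
    (fun q => (q.2, q.2⁻¹ * q.2⁻¹ * q.1 * q.1, q.2⁻¹ * q.1)) ?_ ?_ ?_ ?_
  · rintro ⟨t, a, b⟩ h
    simp only [coe_filter, mem_univ, true_and, Set.mem_ofPred_eq] at h ⊢
    obtain ⟨h₁, h₂⟩ := h
    have ha : (t * b) ^ 2 = t ^ 2 * a := by
      have h := congrArg (t * · * t * b) h₂
      simpa [mul_assoc, pow_two, eq_comm] using h
    have hc : t * a = a * t := mul_inv_eq_iff_eq_mul.1 h₁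
    rw [ha, mul_assoc, ← hc, ← mul_assoc, ← mul_assoc, ← pow_succ, ← pow_succ']
  · rintro ⟨c, t⟩ h
    simp only [coe_filter, mem_univ, true_and, Set.mem_ofPred_eq] at h ⊢
    constructor
    · have h := congrArg (t⁻¹ * t⁻¹ * · * t⁻¹) h
      simpa [mul_assoc, pow_two, eq_comm] using h
    · simp [mul_assoc]
  · rintro ⟨t, a, b⟩ h
    simp only [coe_filter, mem_univ, true_and, Set.mem_ofPred_eq] at h
    have h := congrArg (t⁻¹ * · * t * b) h.2
    simpa [mul_assoc, eq_comm] using h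
  · rintro ⟨c, t⟩ -
    simp

theorem card_conj_rotate :
    #{q : G × G × G | q.1 * (q.2.1⁻¹ * q.2.2) * q.1⁻¹ = q.2.1 ∧
      q.1 * q.2.1⁻¹ * q.1⁻¹ = q.2.2} = #{q : G × G | q.1 ^ 3 = q.2 ^ 3} := by
  refine Finset.card_nbij' (fun q => (q.1, q.1 * q.2.1⁻¹))
    (fun q => (q.1, q.2⁻¹ * q.1, q.2 * q.1⁻¹)) ?_ ?_ ?_ ?_
  · rintro ⟨t, a, b⟩ h
    simp only [coe_filter, mem_univ, true_and, Set.mem_ofPred_eq] at h ⊢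
    obtain ⟨h, rfl⟩ := h
    have h := congrArg (t * a⁻¹ * · * t * t) h
    simpa [mul_assoc, pow_succ, eq_comm] using h
  · rintro ⟨t, c⟩ h
    simp only [coe_filter, mem_univ, true_and, Set.mem_ofPred_eq] at h ⊢
    have h := congrArg (c⁻¹ * · * t⁻¹ * t⁻¹) h
    simpa [mul_assoc, pow_succ, eq_comm] using h
  · rintro ⟨t, a, b⟩ h
    simp only [coe_filter, mem_univ, true_and, Set.mem_ofPred_eq] at h
    simp [← h.2]
  · rintro ⟨t, c⟩ -
    simp

theorem card_conj_inv_rotate :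
    #{q : G × G × G | q.1 * (q.2.1 * q.2.2⁻¹) * q.1⁻¹ = q.2.1 ∧
      q.1 * q.2.1 * q.1⁻¹ = q.2.2} =
      #{q : G × G | q.1 * q.2 * q.1 = q.2 * q.1 ^ 2 * q.2} := by
  convert card_filter_graph (fun t a : G => t * a * t = a * t ^ 2 * a) fun t a => t * a * t⁻¹ using 3
  refine and_congr_left fun h => ?_
  rw [← h]
  simp only [mul_inv_eq_iff_eq_mul, pow_two, mul_inv_rev, inv_inv, ← mul_assoc]

theorem card_conj_map (f : G → G) :
    #{q : G × G × G | q.1 * f q.2.1 * q.1⁻¹ = q.2.1 ∧ q.1 * f q.2.2 * q.1⁻¹ = q.2.2} =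
      ∑ t, #{a | t * f a * t⁻¹ = a} ^ 2 := by
  rw [← sum_card_filter_eq_card_filter_prod fun (t : G) (p : G × G) =>
    t * f p.1 * t⁻¹ = p.1 ∧ t * f p.2 * t⁻¹ = p.2]
  refine Finset.sum_congr rfl fun t _ => ?_
  rw [pow_two, ← Finset.card_product, ← Finset.filter_product, Finset.univ_product_univ]

theorem card_mul_finrank_pairInvariants :
    12 * Fintype.card G * Module.finrank ℂ (pairInvariants G) =
      ∑ t : G, #{a | t * a = a * t} ^ 2 + ∑ t : G, #{a | t = a * t * a} ^ 2 +
      6 * #{q : G × G | q.1 ^ 2 * q.2 = q.2 * q.1 ^ 2} + 2 * #{q : G × G | q.1 ^ 3 = q.2 ^ 3} +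
      2 * #{q : G × G | q.1 * q.2 * q.1 = q.2 * q.1 ^ 2 * q.2} := by
  have h := card_mul_finrank_eq_sum_card_fixed
    (fun (i : (Bool × Fin 6) × G) p =>
      (i.2 * (permuteTriple i.1.2 (cond i.1.1 p⁻¹ p)).1 * i.2⁻¹,
        i.2 * (permuteTriple i.1.2 (cond i.1.1 p⁻¹ p)).2 * i.2⁻¹)) (pairInvariants G) ?_ ?_
  · have hcount (e : Bool) (i : Fin 6) :
        ∑ t : G, #{p : G × G | (t * (permuteTriple i (cond e p⁻¹ p)).1 * t⁻¹,
          t * (permuteTriple i (cond e p⁻¹ p)).2 * t⁻¹) = p} =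
        cond e
          (![∑ t : G, #{a | t * a⁻¹ * t⁻¹ = a} ^ 2,
            #{q : G × G | q.1 ^ 2 * q.2 = q.2 * q.1 ^ 2},
            #{q : G × G | q.1 ^ 2 * q.2 = q.2 * q.1 ^ 2},
            #{q : G × G | q.1 ^ 2 * q.2 = q.2 * q.1 ^ 2},
            #{q : G × G | q.1 * q.2 * q.1 = q.2 * q.1 ^ 2 * q.2},
            #{q : G × G | q.1 * q.2 * q.1 = q.2 * q.1 ^ 2 * q.2}] i)
          (![∑ t : G, #{a | t * a * t⁻¹ = a} ^ 2,
            #{q : G × G | q.1 ^ 2 * q.2 = q.2 * q.1 ^ 2},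
            #{q : G × G | q.1 ^ 2 * q.2 = q.2 * q.1 ^ 2},
            #{q : G × G | q.1 ^ 2 * q.2 = q.2 * q.1 ^ 2},
            #{q : G × G | q.1 ^ 3 = q.2 ^ 3}, #{q : G × G | q.1 ^ 3 = q.2 ^ 3}] i) := by
      simp only [Prod.ext_iff]
      rw [sum_card_filter_eq_card_filter_prod]
      cases e
      · fin_cases i
        · exact card_conj_map id
        · exact card_conj_swap
        · exact card_conj_transpose
        · exact (card_filter_swap (fun t a b : G => t * (a⁻¹ * b) * t⁻¹ = b)
            fun t a b => t * a⁻¹ * t⁻¹ = a).trans card_conj_transpose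
        · exact card_conj_rotate
        · exact (card_filter_swap (fun t a b : G => t * a⁻¹ * t⁻¹ = b)
            fun t a b => t * (a⁻¹ * b) * t⁻¹ = a).trans card_conj_rotate
      · fin_cases i
        · exact card_conj_map (·⁻¹)
        · exact card_conj_inv_swap
        · simpa [permuteTriple] using card_conj_inv_transpose (G := G)
        · simpa [permuteTriple] using (card_filter_swap (fun t a b : G =>
            t * (a * b⁻¹) * t⁻¹ = b) fun t a b => t * a * t⁻¹ = a).trans card_conj_inv_transpose
        · simpa [permuteTriple] using card_conj_inv_rotate (G := G)
        · simpa [permuteTriple] using (card_filter_swap (fun t a b : G => t * a * t⁻¹ = b)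
            fun t a b => t * (a * b⁻¹) * t⁻¹ = a).trans card_conj_inv_rotate
    rw [Fintype.sum_prod_type] at h
    simp only [hcount, Fintype.sum_prod_type, Fintype.sum_bool, Fin.sum_univ_six, cond_true,
      cond_false, Matrix.cons_val, mul_inv_eq_iff_eq_mul, Fintype.card_prod, Fintype.card_bool,
      Fintype.card_fin] at h
    linarith
  · rintro φ ⟨h₁, h₂, h₃, h₄⟩ ⟨⟨e, i⟩, t⟩ ⟨a, b⟩
    have h (p : G × G) : φ (permuteTriple i p) = φ p := by
      fin_cases i
      · rfl
      · exact h₂ _ _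
      · exact h₃ _ _
      · exact (h₂ _ _).trans ((h₃ _ _).trans (h₂ _ _))
      · exact (h₂ _ _).trans (h₃ _ _)
      · exact (h₃ _ _).trans (h₂ _ _)
    refine (h₁ _ _ _).trans ((h _).trans ?_)
    cases e
    exacts [rfl, h₄ a b]
  · intro φ
    convert permuteTriple_sum_mem (fun a b => ∑ t, φ (t * a * t⁻¹, t * b * t⁻¹)) ?_ using 2
    · simp [Fintype.sum_prod_type, Fin.sum_univ_six, permuteTriple]
    · intro u a b
      exact Fintype.sum_equiv (Equiv.mulRight u) _ _ (by simp [mul_assoc])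

end Fintype

end Group

theorem card_filter_prod_eq_mul {A B C D : Type*} [Fintype A] [Fintype B] [Fintype C] [Fintype D]
    (r : A × B → C × D → Prop) (p : A → C → Prop) (q : B → D → Prop) [∀ x, DecidablePred (r x)]
    [∀ a, DecidablePred (p a)] [∀ b, DecidablePred (q b)]
    (h : ∀ x y, r x y ↔ p x.1 y.1 ∧ q x.2 y.2) :
    #{x : (A × B) × C × D | r x.1 x.2} =
      #{x : A × C | p x.1 x.2} * #{x : B × D | q x.1 x.2} := by
  rw [← Finset.card_product]
  exact Finset.card_equiv (Equiv.prodProdProdComm A B C D) (by simp [h])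

theorem sum_card_filter_sq_eq_mul {A B C D : Type*} [Fintype A] [Fintype B] [Fintype C]
    [Fintype D] (r : A × B → C × D → Prop) (p : A → C → Prop) (q : B → D → Prop)
    [∀ x, DecidablePred (r x)] [∀ a, DecidablePred (p a)] [∀ b, DecidablePred (q b)]
    (h : ∀ x y, r x y ↔ p x.1 y.1 ∧ q x.2 y.2) :
    ∑ x, #{y | r x y} ^ 2 = (∑ a, #{c | p a c} ^ 2) * ∑ b, #{d | q b d} ^ 2 := by
  rw [Finset.sum_mul_sum, Fintype.sum_prod_type]
  refine Finset.sum_congr rfl fun a _ => Finset.sum_congr rfl fun b _ => ?_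
  rw [← mul_pow, ← Finset.card_product, ← Finset.filter_product, Finset.univ_product_univ]
  simp only [h]

section BinaryTetrahedral

theorem card_binaryTetrahedralGroup : Fintype.card binaryTetrahedralGroup = 24 := by
  decide +kernel

theorem sum_card_centralizer_sq_binaryTetrahedralGroup :
    ∑ t : binaryTetrahedralGroup, #{a | t * a = a * t} ^ 2 = 1824 := by
  decide +kernel

theorem card_commute_binaryTetrahedralGroup :
    #{q : binaryTetrahedralGroup × binaryTetrahedralGroup | q.1 * q.2 = q.2 * q.1} = 168 := by
  decide +kernel

theorem sum_card_inverting_sq_binaryTetrahedralGroup :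
    ∑ t : binaryTetrahedralGroup, #{a | t = a * t * a} ^ 2 = 288 := by
  decide +kernel

theorem card_inverting_binaryTetrahedralGroup :
    #{q : binaryTetrahedralGroup × binaryTetrahedralGroup | q.1 = q.2 * q.1 * q.2} = 72 := by
  decide +kernel

theorem card_sq_commute_binaryTetrahedralGroup :
    #{q : binaryTetrahedralGroup × binaryTetrahedralGroup |
      q.1 ^ 2 * q.2 = q.2 * q.1 ^ 2} = 288 := by
  have h : ∑ t : binaryTetrahedralGroup, #{a | t * t * a = a * (t * t)} = 288 := by
    decide +kernel
  simpa only [sum_card_filter_eq_card_filter_prod, pow_two] using h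

theorem card_cube_eq_cube_binaryTetrahedralGroup :
    #{q : binaryTetrahedralGroup × binaryTetrahedralGroup | q.1 ^ 3 = q.2 ^ 3} = 168 := by
  have h : ∑ t : binaryTetrahedralGroup,
      #{a : binaryTetrahedralGroup | t * t * t = a * a * a} = 168 := by
    decide +kernel
  simpa only [sum_card_filter_eq_card_filter_prod, pow_three'] using h

theorem card_mul_mul_eq_binaryTetrahedralGroup :
    #{q : binaryTetrahedralGroup × binaryTetrahedralGroup |
      q.1 * q.2 * q.1 = q.2 * q.1 ^ 2 * q.2} = 72 := by
  have h : ∑ t : binaryTetrahedralGroup, #{a | t * a * t = a * (t * t) * a} = 72 := by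
    decide +kernel
  simpa only [sum_card_filter_eq_card_filter_prod, pow_two] using h

end BinaryTetrahedral

theorem card_filter_fst_eq_snd (X : Type*) [Fintype X] [DecidableEq X] :
    #{q : X × X | q.1 = q.2} = Fintype.card X := by
  rw [← sum_card_filter_eq_card_filter_prod fun a b : X => a = b]
  simp [Finset.filter_eq]

theorem mul_mul_eq_mul_sq_mul_iff {A : Type*} [CommGroup A] {t a : A} :
    t * a * t = a * t ^ 2 * a ↔ a = 1 := by
  rw [mul_right_comm, ← pow_two, mul_comm a, left_eq_mul]

section CommGroup

variable {A : Type*} [CommGroup A] [Fintype A]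

theorem pow_left_inj_of_coprime_card {n : ℕ} (h : (Fintype.card A).Coprime n) {a b : A} :
    a ^ n = b ^ n ↔ a = b := by
  rw [← Nat.card_eq_fintype_card] at h
  exact (powCoprime h).injective.eq_iff

theorem eq_mul_mul_iff_eq_one (h : (Fintype.card A).Coprime 2) {t a : A} :
    t = a * t * a ↔ a = 1 := by
  rw [mul_right_comm, right_eq_mul, ← pow_two, ← pow_left_inj_of_coprime_card h (a := a) (b := 1),
    one_pow]

variable [DecidableEq A]

theorem card_filter_snd_eq_one : #{q : A × A | q.2 = 1} = Fintype.card A := by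
  rw [← sum_card_filter_eq_card_filter_prod fun _ a : A => a = 1]
  simp [Finset.filter_eq']

theorem finrank_pairInvariants_prod_binaryTetrahedralGroup (h : (Fintype.card A).Coprime 6) :
    (Module.finrank ℂ (pairInvariants (A × binaryTetrahedralGroup)) : ℚ) =
      19 / 3 * Fintype.card A ^ 2 + 6 * Fintype.card A + 8 / 3 := by
  have h₂ : (Fintype.card A).Coprime 2 := h.coprime_dvd_right (by norm_num)
  have h₃ : (Fintype.card A).Coprime 3 := h.coprime_dvd_right (by norm_num)
  have hA : (Fintype.card A : ℚ) ≠ 0 := by simp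
  have hsq : #{q : (A × binaryTetrahedralGroup) × (A × binaryTetrahedralGroup) |
      q.1 ^ 2 * q.2 = q.2 * q.1 ^ 2} = #{_q : A × A | True} *
        #{q : binaryTetrahedralGroup × binaryTetrahedralGroup | q.1 ^ 2 * q.2 = q.2 * q.1 ^ 2} := by
    convert card_filter_prod_eq_mul
      (fun t a : A × binaryTetrahedralGroup => t ^ 2 * a = a * t ^ 2) (fun _ _ : A => True)
      (fun t a : binaryTetrahedralGroup => t ^ 2 * a = a * t ^ 2)
      (fun x y => by simp [Prod.ext_iff, mul_comm])
  have hcube : #{q : (A × binaryTetrahedralGroup) × (A × binaryTetrahedralGroup) |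
      q.1 ^ 3 = q.2 ^ 3} = #{q : A × A | q.1 = q.2} *
        #{q : binaryTetrahedralGroup × binaryTetrahedralGroup | q.1 ^ 3 = q.2 ^ 3} := by
    convert card_filter_prod_eq_mul
      (fun t a : A × binaryTetrahedralGroup => t ^ 3 = a ^ 3) (fun t a : A => t = a)
      (fun t a : binaryTetrahedralGroup => t ^ 3 = a ^ 3)
      (fun x y => by simp [Prod.ext_iff, pow_left_inj_of_coprime_card h₃])
  have hmul : #{q : (A × binaryTetrahedralGroup) × (A × binaryTetrahedralGroup) |
      q.1 * q.2 * q.1 = q.2 * q.1 ^ 2 * q.2} = #{q : A × A | q.2 = 1} *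
        #{q : binaryTetrahedralGroup × binaryTetrahedralGroup |
          q.1 * q.2 * q.1 = q.2 * q.1 ^ 2 * q.2} := by
    convert card_filter_prod_eq_mul
      (fun t a : A × binaryTetrahedralGroup => t * a * t = a * t ^ 2 * a) (fun _ a : A => a = 1)
      (fun t a : binaryTetrahedralGroup => t * a * t = a * t ^ 2 * a)
      (fun x y => by simp [Prod.ext_iff, mul_mul_eq_mul_sq_mul_iff])
  have key := card_mul_finrank_pairInvariants (G := A × binaryTetrahedralGroup)
  rw [
    sum_card_filter_sq_eq_mul _ (fun _ _ : A => True)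
      (fun t a : binaryTetrahedralGroup => t * a = a * t)
      fun x y => by simp [Prod.ext_iff, mul_comm],
    sum_card_filter_sq_eq_mul _ (fun _ a : A => a = 1)
      (fun t a : binaryTetrahedralGroup => t = a * t * a)
      fun x y => by simp [Prod.ext_iff, eq_mul_mul_iff_eq_one h₂],
    hsq, hcube, hmul,
    sum_card_centralizer_sq_binaryTetrahedralGroup,
    sum_card_inverting_sq_binaryTetrahedralGroup, card_sq_commute_binaryTetrahedralGroup,
    card_cube_eq_cube_binaryTetrahedralGroup, card_mul_mul_eq_binaryTetrahedralGroup,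
    card_filter_fst_eq_snd, card_filter_snd_eq_one, Fintype.card_prod,
    card_binaryTetrahedralGroup] at key
  simp only [Finset.filter_true, Finset.filter_eq', Finset.mem_univ, if_true,
    Finset.card_singleton, Finset.card_univ, Finset.sum_const, smul_eq_mul, one_pow,
    Fintype.card_prod] at key
  have key' := congrArg (Nat.cast (R := ℚ)) key
  push_cast at key'
  refine mul_left_cancel₀ (mul_ne_zero (by norm_num : (288 : ℚ) ≠ 0) hA) ?_
  linear_combination key'

theorem finrank_realClassFunctions_prod_binaryTetrahedralGroup
    (h : (Fintype.card A).Coprime 2) :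
    (Module.finrank ℂ (realClassFunctions (A × binaryTetrahedralGroup)) : ℚ) =
      7 / 2 * Fintype.card A + 3 / 2 := by
  have hA : (Fintype.card A : ℚ) ≠ 0 := by simp
  have key := two_mul_card_mul_finrank_realClassFunctions (G := A × binaryTetrahedralGroup)
  rw [
    card_filter_prod_eq_mul (fun t a => t * a = a * t) (fun _ _ : A => True)
      (fun t a : binaryTetrahedralGroup => t * a = a * t)
      fun x y => by simp [Prod.ext_iff, mul_comm],
    card_filter_prod_eq_mul (fun t a => t = a * t * a) (fun _ a : A => a = 1)
      (fun t a : binaryTetrahedralGroup => t = a * t * a)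
      fun x y => by simp [Prod.ext_iff, eq_mul_mul_iff_eq_one h],
    card_commute_binaryTetrahedralGroup, card_inverting_binaryTetrahedralGroup,
    card_filter_snd_eq_one, Fintype.card_prod, card_binaryTetrahedralGroup] at key
  simp only [Finset.filter_true, Finset.card_univ, Fintype.card_prod] at key
  have key' := congrArg (Nat.cast (R := ℚ)) key
  push_cast at key'
  refine mul_left_cancel₀ (mul_ne_zero (by norm_num : (48 : ℚ) ≠ 0) hA) ?_
  linear_combination key'

end CommGroup

/-- the dimension formulas for `π = (ℤ/mℤ) × T*`, `gcd(m, 6) = 1`. -/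
theorem dim_aThetaOdd_zmod_prod_binaryTetrahedral (m : ℕ) (hm : 1 ≤ m)
    (hcop : Nat.gcd m 6 = 1) :
    (dimAThetaOddGroupAlgebra (Multiplicative (ZMod m) × binaryTetrahedralGroup) : ℚ)
      = (19/3) * m^2 + 6 * m + 8/3 ∧
    (dimAThetaOddKerAug (Multiplicative (ZMod m) × binaryTetrahedralGroup) : ℚ)
      = (19/3) * m^2 + (5/2) * m + 7/6 := by
  have : NeZero m := ⟨by lia⟩
  have hcard : Fintype.card (Multiplicative (ZMod m)) = m := by simp
  have h₆ : (Fintype.card (Multiplicative (ZMod m))).Coprime 6 := by rwa [hcard]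
  have hpair := finrank_pairInvariants_prod_binaryTetrahedralGroup h₆
  have hclass := finrank_realClassFunctions_prod_binaryTetrahedralGroup
    (h₆.coprime_dvd_right (by norm_num))
  have hker := congrArg (Nat.cast (R := ℚ)) (dimAThetaOddKerAug_add_finrank_realClassFunctions
    (G := Multiplicative (ZMod m) × binaryTetrahedralGroup))
  push_cast at hker
  rw [← dimAThetaOddGroupAlgebra_eq_finrank, hcard] at hpair
  rw [hcard] at hclass
  exact ⟨hpair, by linarith⟩
end

section
/- Let π be a finite group and let d₁(π) denote the dimension of the space of (π×π)-invariant elements of Sym³ ℂπ; equivalently, d₁(π) is the number of orbits of π×π×π under the group of bijections generated by permutations of the three coordinates and the maps (x,y,z) ↦ (gxh⁻¹, gyh⁻¹, gzh⁻¹) for g,h ∈ π. Then d₁(π) = (1/(6|π|)) · [ Σ_{C(g) ∈ \hat{π}} ( |π|²/|C(g)| + 3|π|·|C(g)|/|C(g²)| ) + 2 Σ_{(C(g),C(h)) ∈ Δ^{(3)}} |C(g)|·|C(h)|/|C(g³)| ], where the first sum is over the conjugacy classes of π and the second sum is over the set Δ^{(3)} of pairs of conjugacy classes (C(g), C(h))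 such that g³ and h³ are conjugate. -/
/-!
Statement 9: a class-function formula for
`d₁(π) = dim (Sym³ ℂπ)^{π×π}`.

Identifying `(ℂπ)^{⊗3}` with functions `π³ → ℂ`, `d₁(π)` is the dimension of the space of
functions `π³ → ℂ` invariant under permutations of the three coordinates and under the
two-sided action `(x,y,z) ↦ (gxh⁻¹, gyh⁻¹, gzh⁻¹)`; equivalently, it is the number of orbits
of `π×π×π` under the group generated by these transformations.
-/

open scoped BigOperators

/-- `d₁(π) = dim (Sym³ ℂπ)^{π×π}`. -/
noncomputable def d1Theta (G : Type*) [Group G] : ℕ :=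
  Module.finrank ℂ ↥(Submodule.span ℂ
    { f : G × G × G → ℂ |
      (∀ x y z : G, f (y, x, z) = f (x, y, z)) ∧
      (∀ x y z : G, f (x, z, y) = f (x, y, z)) ∧
      (∀ g h x y z : G, f (g * x * h⁻¹, g * y * h⁻¹, g * z * h⁻¹) = f (x, y, z)) })

/-- The map on conjugacy classes induced by `g ↦ g ^ n`. -/
noncomputable def conjClassesPow {G : Type*} [Group G] (n : ℕ) :
    ConjClasses G → ConjClasses G :=
  Quotient.lift (fun g => ConjClasses.mk (g ^ n)) (by
    intro a b hab
    obtain ⟨c, hc⟩ := isConj_iff.mp hab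
    exact ConjClasses.mk_eq_mk_iff_isConj.mpr (isConj_iff.mpr ⟨c, by rw [← hc, conj_pow]⟩))

/-- `𝔖₃ × π × π` acts on triples by permuting the coordinates and by two-sided translation. -/
instance twoSidedPermAction (G : Type*) [Group G] :
    MulAction (Equiv.Perm (Fin 3) × G × G) (Fin 3 → G) where
  smul m x := fun i => m.2.1 * x (m.1⁻¹ i) * m.2.2⁻¹
  one_smul x := by
    funext i
    change 1 * x ((1 : Equiv.Perm (Fin 3))⁻¹ i) * 1⁻¹ = x i
    simp
  mul_smul m n x := by
    funext i
    change (m.2.1 * n.2.1) * x ((m.1 * n.1)⁻¹ i) * (m.2.2 * n.2.2)⁻¹ =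
      m.2.1 * (n.2.1 * x (n.1⁻¹ (m.1⁻¹ i)) * n.2.2⁻¹) * m.2.2⁻¹
    simp [mul_assoc]

theorem twoSidedPermAction_smul_apply {G : Type*} [Group G] (m : Equiv.Perm (Fin 3) × G × G)
    (x : Fin 3 → G) (i : Fin 3) : (m • x) i = m.2.1 * x (m.1⁻¹ i) * m.2.2⁻¹ := rfl

/-- The orbit space of `π³` under `𝔖₃ × π × π`. -/
abbrev TripleOrbits (G : Type*) [Group G] : Type _ :=
  MulAction.orbitRel.Quotient (Equiv.Perm (Fin 3) × G × G) (Fin 3 → G)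

/-- The orbit of a triple. -/
def tripleOrbit {G : Type*} [Group G] (p : G × G × G) : TripleOrbits G :=
  Quotient.mk _ ![p.1, p.2.1, p.2.2]

theorem tripleOrbit_surjective (G : Type*) [Group G] :
    Function.Surjective (tripleOrbit : G × G × G → TripleOrbits G) := by
  intro q
  induction q using Quotient.inductionOn with
  | h x =>
    refine ⟨(x 0, x 1, x 2), congrArg (Quotient.mk _) ?_⟩
    funext i
    fin_cases i <;> rfl

theorem tripleOrbit_eq_of_smul {G : Type*} [Group G] (m : Equiv.Perm (Fin 3) × G × G)
    {p q : G × G × G} (h : m • ![q.1, q.2.1, q.2.2] = ![p.1, p.2.1, p.2.2]) :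
    tripleOrbit p = tripleOrbit q :=
  Quotient.sound ⟨m, h⟩

theorem perm_fin_three_values (σ : Equiv.Perm (Fin 3)) :
    (σ 0, σ 1, σ 2) ∈ ([(0, 1, 2), (1, 0, 2), (0, 2, 1), (2, 1, 0), (1, 2, 0), (2, 0, 1)] :
      List (Fin 3 × Fin 3 × Fin 3)) := by
  revert σ
  decide

theorem d1Theta_eq_card_tripleOrbits (G : Type*) [Group G] [Finite G] :
    d1Theta G = Nat.card (TripleOrbits G) := by
  have hset : { f : G × G × G → ℂ |
      (∀ x y z : G, f (y, x, z) = f (x, y, z)) ∧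
      (∀ x y z : G, f (x, z, y) = f (x, y, z)) ∧
      (∀ g h x y z : G, f (g * x * h⁻¹, g * y * h⁻¹, g * z * h⁻¹) = f (x, y, z)) } =
      (LinearMap.range (LinearMap.funLeft ℂ ℂ (tripleOrbit (G := G))) :
        Set (G × G × G → ℂ)) := by
    ext f
    simp only [Set.mem_ofPred_eq, SetLike.mem_coe, LinearMap.mem_range]
    constructor
    · rintro ⟨h₁, h₂, h₃⟩
      refine ⟨Quotient.lift (fun x : Fin 3 → G => f (x 0, x 1, x 2)) ?_, rfl⟩
      rintro _ x ⟨⟨σ, g, h⟩, rfl⟩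
      simp only [twoSidedPermAction_smul_apply, h₃]
      have hσ := perm_fin_three_values σ⁻¹
      simp only [List.mem_cons, Prod.mk.injEq, List.not_mem_nil, or_false] at hσ
      rcases hσ with ⟨h0, h1, h2⟩ | ⟨h0, h1, h2⟩ | ⟨h0, h1, h2⟩ | ⟨h0, h1, h2⟩ |
        ⟨h0, h1, h2⟩ | ⟨h0, h1, h2⟩ <;> rw [h0, h1, h2] <;> grind
    · rintro ⟨F, rfl⟩
      refine ⟨fun x y z => congrArg F ?_, fun x y z => congrArg F ?_,
        fun g h x y z => congrArg F ?_⟩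
      · refine tripleOrbit_eq_of_smul (Equiv.swap 0 1, 1, 1) ?_
        funext i
        fin_cases i <;> simp [twoSidedPermAction_smul_apply, Equiv.swap_apply_def]
      · refine tripleOrbit_eq_of_smul (Equiv.swap 1 2, 1, 1) ?_
        funext i
        fin_cases i <;> simp [twoSidedPermAction_smul_apply, Equiv.swap_apply_def]
      · refine tripleOrbit_eq_of_smul (1, g, h) ?_
        funext i
        fin_cases i <;> simp [twoSidedPermAction_smul_apply]
  have := Fintype.ofFinite (TripleOrbits G)
  rw [d1Theta, hset, Submodule.span_eq, LinearMap.finrank_range_of_inj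
    (LinearMap.funLeft_injective_of_surjective ℂ ℂ _ (tripleOrbit_surjective G)),
    Module.finrank_fintype_fun_eq_card, Nat.card_eq_fintype_card]

/-- The number of `x` with `g * x * h⁻¹ = x`. -/
noncomputable def intertwinerCount {G : Type*} [Group G] (g h : G) : ℕ :=
  Nat.card { x : G // g * x * h⁻¹ = x }

open scoped Classical in
/-- The value of `intertwinerCount` on a pair of conjugacy classes. -/
noncomputable def classIntertwinerCount {G : Type*} [Group G] (c d : ConjClasses G) : ℚ :=
  if c = d then (Nat.card G : ℚ) / Nat.card c.carrier else 0

theorem ConjClasses.card_carrier_pos {G : Type*} [Group G] [Finite G] (c : ConjClasses G) :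
    0 < Nat.card c.carrier := by
  induction c using Quotient.inductionOn with
  | h g => exact Nat.card_pos_iff.mpr ⟨⟨⟨g, ConjClasses.mem_carrier_mk⟩⟩, inferInstance⟩

theorem intertwinerCount_eq {G : Type*} [Group G] [Finite G] (g h : G) :
    (intertwinerCount g h : ℚ) =
      classIntertwinerCount (ConjClasses.mk g) (ConjClasses.mk h) := by
  unfold classIntertwinerCount intertwinerCount
  split_ifs with hgh
  · obtain ⟨c, hc⟩ := isConj_iff.mp (ConjClasses.mk_eq_mk_iff_isConj.mp hgh)
    have e : { x : G // g * x * h⁻¹ = x } ≃ MulAction.stabilizer (ConjAct G) g :=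
      { toFun := fun x => ⟨ConjAct.toConjAct (x.1 * c), by
          rw [MulAction.mem_stabilizer_iff, ConjAct.smul_def]
          have := x.2
          simp only [ConjAct.ofConjAct_toConjAct]
          rw [mul_inv_eq_iff_eq_mul] at this ⊢
          rw [← mul_assoc, this, mul_assoc, mul_assoc,
            mul_inv_eq_iff_eq_mul.mp hc]⟩
        invFun := fun y => ⟨ConjAct.ofConjAct y.1 * c⁻¹, by
          have := y.2
          rw [MulAction.mem_stabilizer_iff, ConjAct.smul_def] at this
          rw [mul_inv_eq_iff_eq_mul] at this ⊢
          rw [← mul_assoc, ← this, ← hc]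
          group⟩
        left_inv := fun x => by simp
        right_inv := fun y => by simp }
    rw [Nat.card_congr e, eq_div_iff
      (Nat.cast_ne_zero.mpr (ConjClasses.card_carrier_pos (ConjClasses.mk g)).ne')]
    rw [← ConjAct.orbit_eq_carrier_conjClasses]
    norm_cast
    rw [mul_comm, ← Nat.card_prod,
      Nat.card_congr (MulAction.orbitProdStabilizerEquivGroup (ConjAct G) g)]
    exact Nat.card_congr ConjAct.ofConjAct.toEquiv
  · rw [Nat.cast_eq_zero, Nat.card_eq_zero]
    left
    refine ⟨fun x => hgh (ConjClasses.mk_eq_mk_iff_isConj.mpr (isConj_iff.mpr ⟨x.1⁻¹, ?_⟩))⟩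
    have := x.2
    rw [mul_inv_eq_iff_eq_mul] at this
    rw [inv_inv, mul_assoc, this]
    group

theorem card_fixedBy_one {G : Type*} [Group G] (g h : G) :
    Nat.card (MulAction.fixedBy (Fin 3 → G) ((1, g, h) : Equiv.Perm (Fin 3) × G × G)) =
      intertwinerCount g h ^ 3 := by
  have e : MulAction.fixedBy (Fin 3 → G) ((1, g, h) : Equiv.Perm (Fin 3) × G × G) ≃
      (Fin 3 → { x : G // g * x * h⁻¹ = x }) :=
    { toFun := fun x i => ⟨x.1 i, congrFun x.2 i⟩
      invFun := fun y => ⟨fun i => (y i).1, funext fun i => (y i).2⟩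
      left_inv := fun _ => rfl
      right_inv := fun _ => rfl }
  rw [Nat.card_congr e, Nat.card_fun, Nat.card_fin, intertwinerCount]

theorem card_fixedBy_swap {G : Type*} [Group G] (g h : G) {σ : Equiv.Perm (Fin 3)}
    {i j k : Fin 3} (hi : σ⁻¹ i = j) (hj : σ⁻¹ j = i) (hk : σ⁻¹ k = k)
    (hij : i ≠ j) (hik : i ≠ k) (hjk : j ≠ k) :
    Nat.card (MulAction.fixedBy (Fin 3 → G) ((σ, g, h) : Equiv.Perm (Fin 3) × G × G)) =
      intertwinerCount (g ^ 2) (h ^ 2) * intertwinerCount g h := by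
  have hl (l : Fin 3) : l = i ∨ l = j ∨ l = k := by grind
  have e : MulAction.fixedBy (Fin 3 → G) ((σ, g, h) : Equiv.Perm (Fin 3) × G × G) ≃
      { x : G // g ^ 2 * x * (h ^ 2)⁻¹ = x } × { x : G // g * x * h⁻¹ = x } :=
    { toFun := fun x => by
        refine ⟨⟨x.1 i, ?_⟩, ⟨x.1 k, ?_⟩⟩
        · have h₁ := congrFun x.2 i
          have h₂ := congrFun x.2 j
          rw [twoSidedPermAction_smul_apply] at h₁ h₂
          simp only [hi, hj] at h₁ h₂
          rw [← h₂] at h₁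
          simpa [pow_two, mul_assoc] using h₁
        · have h₁ := congrFun x.2 k
          rw [twoSidedPermAction_smul_apply] at h₁
          simpa only [hk] using h₁
      invFun := fun y => ⟨fun l => if l = i then y.1.1 else if l = j then g * y.1.1 * h⁻¹
          else y.2.1, by
        have h₁ := y.1.2
        have h₂ := y.2.2
        simp only [pow_two, mul_inv_rev, mul_assoc] at h₁ h₂
        funext l
        rw [twoSidedPermAction_smul_apply]
        rcases hl l with rfl | rfl | rfl
        · simp [hi, hij.symm, mul_assoc, h₁]
        · simp [hj, hij.symm]
        · simp [hk, hik.symm, hjk.symm, mul_assoc, h₂]⟩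
      left_inv := fun x => by
        have h₂ := congrFun x.2 j
        rw [twoSidedPermAction_smul_apply] at h₂
        simp only [hj] at h₂
        ext l
        rcases hl l with rfl | rfl | rfl
        · simp
        · simp [hij.symm, h₂]
        · simp [hik.symm, hjk.symm]
      right_inv := fun y => by
        ext <;> simp [hik.symm, hjk.symm] }
  rw [Nat.card_congr e, Nat.card_prod, intertwinerCount, intertwinerCount]

theorem card_fixedBy_threeCycle {G : Type*} [Group G] (g h : G) {σ : Equiv.Perm (Fin 3)}
    {i j k : Fin 3} (hi : σ⁻¹ i = j) (hj : σ⁻¹ j = k) (hk : σ⁻¹ k = i)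
    (hij : i ≠ j) (hik : i ≠ k) (hjk : j ≠ k) :
    Nat.card (MulAction.fixedBy (Fin 3 → G) ((σ, g, h) : Equiv.Perm (Fin 3) × G × G)) =
      intertwinerCount (g ^ 3) (h ^ 3) := by
  have hl (l : Fin 3) : l = i ∨ l = j ∨ l = k := by grind
  have e : MulAction.fixedBy (Fin 3 → G) ((σ, g, h) : Equiv.Perm (Fin 3) × G × G) ≃
      { x : G // g ^ 3 * x * (h ^ 3)⁻¹ = x } :=
    { toFun := fun x => by
        refine ⟨x.1 i, ?_⟩
        have h₁ := congrFun x.2 i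
        have h₂ := congrFun x.2 j
        have h₃ := congrFun x.2 k
        rw [twoSidedPermAction_smul_apply] at h₁ h₂ h₃
        simp only [hi, hj, hk] at h₁ h₂ h₃
        rw [← h₂, ← h₃] at h₁
        simpa [pow_succ, mul_assoc] using h₁
      invFun := fun y => ⟨fun l => if l = i then y.1 else if l = k then g * y.1 * h⁻¹
          else g * (g * y.1 * h⁻¹) * h⁻¹, by
        have h₁ := y.2
        simp only [pow_succ, pow_zero, one_mul, mul_inv_rev, mul_assoc] at h₁
        funext l
        rw [twoSidedPermAction_smul_apply]
        rcases hl l with rfl | rfl | rfl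
        · simp [hi, hij.symm, hjk, mul_assoc, h₁]
        · simp [hj, hij.symm, hik.symm, hjk, mul_assoc]
        · simp [hk, hik.symm]⟩
      left_inv := fun x => by
        have h₂ := congrFun x.2 j
        have h₃ := congrFun x.2 k
        rw [twoSidedPermAction_smul_apply] at h₂ h₃
        simp only [hj, hk] at h₂ h₃
        ext l
        rcases hl l with rfl | rfl | rfl
        · simp
        · simp [hij.symm, hjk, h₂, h₃]
        · simp [hik.symm, h₃]
      right_inv := fun y => by
        ext
        simp }
  rw [Nat.card_congr e, intertwinerCount]

theorem sum_perm_fin_three {M : Type*} [AddCommMonoid M] (F : Equiv.Perm (Fin 3) → M) :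
    ∑ σ, F σ = F 1 + F (Equiv.swap 0 1) + F (Equiv.swap 0 2) + F (Equiv.swap 1 2) +
      F (finRotate 3) + F (finRotate 3)⁻¹ := by
  have : (Finset.univ : Finset (Equiv.Perm (Fin 3))) =
      {1, Equiv.swap 0 1, Equiv.swap 0 2, Equiv.swap 1 2, finRotate 3, (finRotate 3)⁻¹} := by
    decide
  rw [this]
  repeat rw [Finset.sum_insert (by decide)]
  rw [Finset.sum_singleton]
  simp only [add_assoc]

/-- Summing a class function over the group, class by class. -/
theorem sum_conjClasses_mk {G : Type*} [Group G] [Fintype G] [Fintype (ConjClasses G)]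
    (F : ConjClasses G → ℚ) :
    ∑ g, F (ConjClasses.mk g) = ∑ c : ConjClasses G, (Nat.card c.carrier : ℚ) * F c := by
  classical
  rw [← Finset.sum_fiberwise Finset.univ (ConjClasses.mk : G → ConjClasses G)]
  refine Finset.sum_congr rfl fun c _ => ?_
  rw [Finset.sum_congr rfl (g := fun _ => F c) (by simp +contextual), Finset.sum_const,
    nsmul_eq_mul, ConjClasses.carrier_eq_preimage_mk, Nat.card_coe_set_eq,
    Set.ncard_eq_toFinset_card']
  congr 3
  ext g
  simp

theorem six_mul_sq_mul_card_tripleOrbits (G : Type*) [Group G] [Fintype G] :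
    (6 * (Nat.card G : ℚ) ^ 2) * (Nat.card (TripleOrbits G) : ℚ) =
      ∑ g : G, ∑ h : G, ((intertwinerCount g h : ℚ) ^ 3
        + 3 * (intertwinerCount (g ^ 2) (h ^ 2) * intertwinerCount g h)
        + 2 * intertwinerCount (g ^ 3) (h ^ 3)) := by
  classical
  have := Fintype.ofFinite (TripleOrbits G)
  have key := MulAction.sum_card_fixedBy_eq_card_orbits_mul_card_group
    (Equiv.Perm (Fin 3) × G × G) (Fin 3 → G)
  simp only [← Nat.card_eq_fintype_card, Nat.card_prod, Fintype.sum_prod_type,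
    sum_perm_fin_three, Nat.card_perm, Nat.card_fin] at key
  simp only [card_fixedBy_one] at key
  simp only [fun g h : G => card_fixedBy_swap g h (σ := Equiv.swap 0 1) (i := 0) (j := 1) (k := 2)
    (by decide) (by decide) (by decide) (by decide) (by decide) (by decide),
    fun g h : G => card_fixedBy_swap g h (σ := Equiv.swap 0 2) (i := 0) (j := 2) (k := 1)
    (by decide) (by decide) (by decide) (by decide) (by decide) (by decide),
    fun g h : G => card_fixedBy_swap g h (σ := Equiv.swap 1 2) (i := 1) (j := 2) (k := 0)
    (by decide) (by decide) (by decide) (by decide) (by decide) (by decide),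
    fun g h : G => card_fixedBy_threeCycle g h (σ := finRotate 3) (i := 0) (j := 2) (k := 1)
    (by decide) (by decide) (by decide) (by decide) (by decide) (by decide),
    fun g h : G => card_fixedBy_threeCycle g h (σ := (finRotate 3)⁻¹) (i := 0) (j := 1) (k := 2)
    (by decide) (by decide) (by decide) (by decide) (by decide) (by decide)] at key
  have key' := congrArg (Nat.cast : ℕ → ℚ) key
  push_cast [Nat.factorial] at key'
  simp only [Finset.sum_add_distrib, ← Finset.mul_sum] at key' ⊢
  linarith

/-- for a finite group `π`,
`d₁(π) = (1/(6|π|)) · [ Σ_C ( |π|²/|C| + 3|π|·|C|/|C²| ) + 2 Σ_{(C,C') ∈ Δ^{(3)}} |C||C'|/|C³| ]`,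
where `C²`, `C³` denote the classes of squares and of cubes of elements of `C`, and `Δ^{(3)}`
is the set of pairs of classes whose cubes give the same class. -/
theorem d1Theta_eq_conjClasses_sum (G : Type*) [Group G] [Finite G] :
    (d1Theta G : ℚ) =
      (1 / (6 * (Nat.card G : ℚ))) *
        ((∑ᶠ c : ConjClasses G,
            ((Nat.card G : ℚ)^2 / (Nat.card ↥c.carrier : ℚ)
              + 3 * (Nat.card G : ℚ) * (Nat.card ↥c.carrier : ℚ)
                / (Nat.card ↥(conjClassesPow 2 c).carrier : ℚ)))
          + 2 * ∑ᶠ q ∈ {q : ConjClasses G × ConjClasses G |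
                conjClassesPow 3 q.1 = conjClassesPow 3 q.2},
              (Nat.card ↥q.1.carrier : ℚ) * (Nat.card ↥q.2.carrier : ℚ)
                / (Nat.card ↥(conjClassesPow 3 q.1).carrier : ℚ)) := by
  classical
  have := Fintype.ofFinite G
  have := Fintype.ofFinite (ConjClasses G)
  have hG : (Nat.card G : ℚ) ≠ 0 := Nat.cast_ne_zero.mpr Nat.card_pos.ne'
  have hC (c : ConjClasses G) : (Nat.card c.carrier : ℚ) ≠ 0 :=
    Nat.cast_ne_zero.mpr (ConjClasses.card_carrier_pos c).ne'
  have hpow (n : ℕ) (g : G) : ConjClasses.mk (g ^ n) = conjClassesPow n (ConjClasses.mk g) := rfl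
  have key := six_mul_sq_mul_card_tripleOrbits G
  simp only [intertwinerCount_eq, hpow] at key
  rw [Finset.sum_congr rfl fun g _ => sum_conjClasses_mk fun d =>
      classIntertwinerCount (ConjClasses.mk g) d ^ 3 + 3 * (classIntertwinerCount
        (conjClassesPow 2 (ConjClasses.mk g)) (conjClassesPow 2 d) *
        classIntertwinerCount (ConjClasses.mk g) d) + 2 * classIntertwinerCount
        (conjClassesPow 3 (ConjClasses.mk g)) (conjClassesPow 3 d),
    sum_conjClasses_mk fun c => ∑ d : ConjClasses G, (Nat.card d.carrier : ℚ) *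
      (classIntertwinerCount c d ^ 3 + 3 * (classIntertwinerCount
        (conjClassesPow 2 c) (conjClassesPow 2 d) * classIntertwinerCount c d) +
        2 * classIntertwinerCount (conjClassesPow 3 c) (conjClassesPow 3 d))] at key
  rw [d1Theta_eq_card_tripleOrbits, finsum_eq_sum_of_fintype,
    finsum_mem_eq_finite_toFinset_sum _ (Set.toFinite _)]
  have hpairs : (Nat.card G : ℚ) * ∑ q ∈ (Set.toFinite {q : ConjClasses G × ConjClasses G |
        conjClassesPow 3 q.1 = conjClassesPow 3 q.2}).toFinset,
      (Nat.card q.1.carrier : ℚ) * (Nat.card q.2.carrier : ℚ) /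
        (Nat.card (conjClassesPow 3 q.1).carrier : ℚ) =
      ∑ c : ConjClasses G, ∑ d : ConjClasses G, (Nat.card c.carrier : ℚ) *
        ((Nat.card d.carrier : ℚ) *
          classIntertwinerCount (conjClassesPow 3 c) (conjClassesPow 3 d)) := by
    rw [← Fintype.sum_prod_type', Finset.mul_sum, ← Finset.sum_subset (Finset.subset_univ _)]
    · refine Finset.sum_congr rfl fun q hq => ?_
      rw [classIntertwinerCount, if_pos (by simpa using hq)]
      field_simp
    · intro q _ hq
      rw [classIntertwinerCount, if_neg (by simpa using hq)]
      simp
  have hdiag (c : ConjClasses G) : (Nat.card c.carrier : ℚ) * ∑ d : ConjClasses G,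
      (Nat.card d.carrier : ℚ) * (classIntertwinerCount c d ^ 3 + 3 * (classIntertwinerCount
        (conjClassesPow 2 c) (conjClassesPow 2 d) * classIntertwinerCount c d)) =
      (Nat.card G : ℚ) * ((Nat.card G : ℚ) ^ 2 / (Nat.card c.carrier : ℚ)
        + 3 * (Nat.card G : ℚ) * (Nat.card c.carrier : ℚ)
          / (Nat.card (conjClassesPow 2 c).carrier : ℚ)) := by
    rw [Finset.sum_eq_single c]
    · simp only [classIntertwinerCount, if_true]
      have h₁ := hC c
      have h₂ := hC (conjClassesPow 2 c)
      field_simp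
    · intro d _ hd
      simp [classIntertwinerCount, hd.symm]
    · simp
  have hsum : ∀ c : ConjClasses G, (Nat.card c.carrier : ℚ) * ∑ d : ConjClasses G,
      (Nat.card d.carrier : ℚ) * (classIntertwinerCount c d ^ 3 + 3 * (classIntertwinerCount
        (conjClassesPow 2 c) (conjClassesPow 2 d) * classIntertwinerCount c d) +
        2 * classIntertwinerCount (conjClassesPow 3 c) (conjClassesPow 3 d)) =
      (Nat.card G : ℚ) * ((Nat.card G : ℚ) ^ 2 / (Nat.card c.carrier : ℚ)
        + 3 * (Nat.card G : ℚ) * (Nat.card c.carrier : ℚ)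
          / (Nat.card (conjClassesPow 2 c).carrier : ℚ)) +
      2 * ∑ d : ConjClasses G, (Nat.card c.carrier : ℚ) * ((Nat.card d.carrier : ℚ) *
          classIntertwinerCount (conjClassesPow 3 c) (conjClassesPow 3 d)) := by
    intro c
    rw [← hdiag c, Finset.mul_sum, Finset.mul_sum, Finset.mul_sum, ← Finset.sum_add_distrib]
    exact Finset.sum_congr rfl fun d _ => by ring
  rw [Finset.sum_congr rfl fun c _ => hsum c, Finset.sum_add_distrib, ← Finset.mul_sum,
    ← Finset.mul_sum] at key
  rw [one_div, eq_inv_mul_iff_mul_eq₀ (mul_ne_zero (by norm_num) hG)]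
  refine mul_left_cancel₀ hG ?_
  linear_combination key - 2 * hpairs
end

section
/- Let n ≥ 1. Consider the orbits of (ℤ/nℤ)³ under the group of bijections generated by permutations of the three coordinates and the simultaneous translations (x,y,z) ↦ (x+a, y+a, z+a) for a ∈ ℤ/nℤ. The number of such orbits that are mapped to themselves by coordinatewise negation (x,y,z) ↦ (−x,−y,−z) equals (1/2)n + 1 if n is even and (n+1)/2 if n is odd. -/
/-!
Statement 12: among the orbits of `(ℤ/nℤ)³` under the group of bijections generated by the
permutations of the three coordinates and the simultaneous translations
`(x,y,z) ↦ (x+a, y+a, z+a)`, the number of orbits mapped to themselves by coordinatewise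
negation is `n/2 + 1` for even `n` and `(n+1)/2` for odd `n`.
-/

/-- The transposition of the first two coordinates of a triple. -/
def permSwap12 (n : ℕ) : Equiv.Perm (ZMod n × ZMod n × ZMod n) :=
  ⟨fun t => (t.2.1, t.1, t.2.2), fun t => (t.2.1, t.1, t.2.2), fun _ => rfl, fun _ => rfl⟩

/-- The transposition of the first and third coordinates of a triple. -/
def permSwap13 (n : ℕ) : Equiv.Perm (ZMod n × ZMod n × ZMod n) :=
  ⟨fun t => (t.2.2, t.2.1, t.1), fun t => (t.2.2, t.2.1, t.1), fun _ => rfl, fun _ => rfl⟩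

/-- The transposition of the last two coordinates of a triple. -/
def permSwap23 (n : ℕ) : Equiv.Perm (ZMod n × ZMod n × ZMod n) :=
  ⟨fun t => (t.1, t.2.2, t.2.1), fun t => (t.1, t.2.2, t.2.1), fun _ => rfl, fun _ => rfl⟩

/-- The simultaneous translation `(x,y,z) ↦ (x+a, y+a, z+a)`. -/
def permTranslate (n : ℕ) (a : ZMod n) : Equiv.Perm (ZMod n × ZMod n × ZMod n) :=
  (Equiv.addRight a).prodCongr ((Equiv.addRight a).prodCongr (Equiv.addRight a))

/-- The group of bijections of `(ℤ/nℤ)³` generated by the coordinate permutations and the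
simultaneous translations. -/
def permTransGroup (n : ℕ) : Subgroup (Equiv.Perm (ZMod n × ZMod n × ZMod n)) :=
  Subgroup.closure
    ({permSwap12 n, permSwap13 n, permSwap23 n} ∪ Set.range (permTranslate n))

/-- Two triples agree up to a permutation of the coordinates and a simultaneous translation. -/
def TranslatePermRel {A : Type*} [AddCommGroup A] (v w : A × A × A) : Prop :=
  ∃ a, w = (v.1 + a, v.2.1 + a, v.2.2 + a) ∨ w = (v.1 + a, v.2.2 + a, v.2.1 + a) ∨
    w = (v.2.1 + a, v.1 + a, v.2.2 + a) ∨ w = (v.2.1 + a, v.2.2 + a, v.1 + a) ∨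
    w = (v.2.2 + a, v.1 + a, v.2.1 + a) ∨ w = (v.2.2 + a, v.2.1 + a, v.1 + a)

namespace TranslatePermRel

variable {A : Type*} [AddCommGroup A] {u v w : A × A × A}

theorem refl (v : A × A × A) : TranslatePermRel v v := ⟨0, by simp⟩

theorem symm (h : TranslatePermRel v w) : TranslatePermRel w v := by
  obtain ⟨a, h⟩ := h
  refine ⟨-a, ?_⟩
  rcases h with h | h | h | h | h | h <;> subst h <;> simp

theorem trans (h : TranslatePermRel u v) (h' : TranslatePermRel v w) :
    TranslatePermRel u w := by
  obtain ⟨a, h⟩ := h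
  obtain ⟨b, h'⟩ := h'
  refine ⟨a + b, ?_⟩
  rcases h with h | h | h | h | h | h <;> subst h <;>
    rcases h' with h | h | h | h | h | h <;> subst h <;> simp [add_assoc]

theorem neg (h : TranslatePermRel v w) : TranslatePermRel (-v) (-w) := by
  obtain ⟨a, h⟩ := h
  refine ⟨-a, ?_⟩
  rcases h with h | h | h | h | h | h <;> subst h <;> simp [add_comm]

/-- Triples of the form `(t, -t, 0)` are equivalent only if their parameters agree up to sign. -/
theorem eq_or_eq_neg {s t : A} (h : TranslatePermRel (s, -s, 0) (t, -t, 0)) :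
    s = t ∨ s = -t := by
  obtain ⟨a, h⟩ := h
  simp only [Prod.mk.injEq] at h
  grind

theorem neg_param (t : A) : TranslatePermRel (t, -t, 0) (-t, t, 0) := ⟨0, by simp⟩

end TranslatePermRel

theorem ZMod.eq_zero_or_eq_of_neg_eq_self {n : ℕ} [NeZero n] {d e : ZMod n}
    (hd : -d = d) (he : -e = e) : d = 0 ∨ e = 0 ∨ d = e := by
  rcases (ZMod.neg_eq_self_iff d).1 hd with hd | hd
  · exact Or.inl hd
  rcases (ZMod.neg_eq_self_iff e).1 he with he | he
  · exact Or.inr (Or.inl he)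
  exact Or.inr (Or.inr (ZMod.val_injective n (by omega)))

/-- A triple equivalent to its negative is equivalent to one of the form `(t, -t, 0)`. -/
theorem TranslatePermRel.exists_of_neg {n : ℕ} [NeZero n] {v : ZMod n × ZMod n × ZMod n}
    (h : TranslatePermRel v (-v)) : ∃ t, TranslatePermRel (t, -t, 0) v := by
  obtain ⟨x, y, z⟩ := v
  have of_z (h : x + y = z + z) : ∃ t, TranslatePermRel (t, -t, 0) (x, y, z) :=
    ⟨x - z, z, by simp only [Prod.mk.injEq]; grind⟩
  have of_y (h : x + z = y + y) : ∃ t, TranslatePermRel (t, -t, 0) (x, y, z) :=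
    ⟨x - y, y, by simp only [Prod.mk.injEq]; grind⟩
  have of_x (h : y + z = x + x) : ∃ t, TranslatePermRel (t, -t, 0) (x, y, z) :=
    ⟨y - x, x, by simp only [Prod.mk.injEq]; grind⟩
  obtain ⟨a, h⟩ := h
  simp only [Prod.neg_mk, Prod.mk.injEq] at h
  rcases h with ⟨h₁, h₂, h₃⟩ | ⟨h₁, h₂, h₃⟩ | ⟨h₁, h₂, h₃⟩ | ⟨h₁, h₂, h₃⟩ | ⟨h₁, h₂, h₃⟩ |
    ⟨h₁, h₂, h₃⟩
  · rcases ZMod.eq_zero_or_eq_of_neg_eq_self (d := x - z) (e := y - z) (by grind) (by grind)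
      with h | h | h
    · exact of_y (by grind)
    · exact of_x (by grind)
    · exact of_z (by grind)
  · exact of_x (by grind)
  · exact of_z (by grind)
  · exact of_z (by grind)
  · exact of_z (by grind)
  · exact of_y (by grind)

theorem mem_orbit_permTransGroup_iff {n : ℕ} {v w : ZMod n × ZMod n × ZMod n} :
    w ∈ MulAction.orbit (permTransGroup n) v ↔ TranslatePermRel v w := by
  constructor
  · rintro ⟨⟨g, hg⟩, rfl⟩
    change TranslatePermRel v (g v)
    induction hg using Subgroup.closure_induction generalizing v with
    | mem g hg =>
      rcases hg with (rfl | rfl | rfl) | ⟨a, rfl⟩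
      · exact ⟨0, by simp [permSwap12]⟩
      · exact ⟨0, by simp [permSwap13]⟩
      · exact ⟨0, by simp [permSwap23]⟩
      · exact ⟨a, Or.inl rfl⟩
    | one => exact .refl v
    | mul g g' _ _ hg hg' => exact hg'.trans hg
    | inv g _ hg => simpa using (hg (v := g⁻¹ v)).symm
  · rintro ⟨a, h⟩
    have mem {g : Equiv.Perm (ZMod n × ZMod n × ZMod n)} (u)
        (hg : g ∈ ({permSwap12 n, permSwap13 n, permSwap23 n} ∪ Set.range (permTranslate n) :
          Set (Equiv.Perm (ZMod n × ZMod n × ZMod n))))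
        (hu : u ∈ MulAction.orbit (permTransGroup n) v) :
        g u ∈ MulAction.orbit (permTransGroup n) v :=
      MulAction.mem_orbit_of_mem_orbit (⟨g, Subgroup.subset_closure hg⟩ : permTransGroup n) hu
    have h₁₂ u := mem (g := permSwap12 n) u (by simp)
    have h₁₃ u := mem (g := permSwap13 n) u (by simp)
    have h₂₃ u := mem (g := permSwap23 n) u (by simp)
    have h₀ := mem (g := permTranslate n a) v (by simp) (MulAction.mem_orbit_self v)
    rcases h with rfl | rfl | rfl | rfl | rfl | rfl
    · exact h₀
    · exact h₂₃ _ h₀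
    · exact h₁₂ _ h₀
    · exact h₂₃ _ (h₁₂ _ h₀)
    · exact h₁₂ _ (h₂₃ _ h₀)
    · exact h₁₃ _ h₀

theorem neg_image_orbit_eq_iff {n : ℕ} (v : ZMod n × ZMod n × ZMod n) :
    (fun v => -v) '' MulAction.orbit (permTransGroup n) v =
      MulAction.orbit (permTransGroup n) v ↔ TranslatePermRel v (-v) := by
  constructor
  · intro h
    rw [← mem_orbit_permTransGroup_iff, ← h]
    exact Set.mem_image_of_mem _ (MulAction.mem_orbit_self v)
  · intro h
    ext w
    simp only [Set.image_neg_eq_neg, Set.mem_neg, mem_orbit_permTransGroup_iff]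
    exact ⟨fun hw => by simpa using h.trans hw.neg, fun hw => h.trans hw.neg⟩

theorem card_neg_invariant_orbits_eq (n : ℕ) [NeZero n] :
    Nat.card {q : MulAction.orbitRel.Quotient (permTransGroup n)
        (ZMod n × ZMod n × ZMod n) // (fun v => -v) '' q.orbit = q.orbit} = n / 2 + 1 := by
  have pos := NeZero.pos n
  have inv (t : ZMod n) : (fun v => -v) ''
      MulAction.orbit (permTransGroup n) (t, -t, (0 : ZMod n)) =
        MulAction.orbit (permTransGroup n) (t, -t, (0 : ZMod n)) :=
    (neg_image_orbit_eq_iff _).2 (by simpa using TranslatePermRel.neg_param t)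
  let f (k : Fin (n / 2 + 1)) : {q : MulAction.orbitRel.Quotient (permTransGroup n)
        (ZMod n × ZMod n × ZMod n) // (fun v => -v) '' q.orbit = q.orbit} :=
    ⟨Quotient.mk'' ((k : ℕ), -(k : ℕ), 0), inv _⟩
  have hf : f.Bijective := by
    constructor
    · intro k l hkl
      have hkl := mem_orbit_permTransGroup_iff.1 (Quotient.exact' (Subtype.ext_iff.1 hkl))
      have hk := k.2
      have hl := l.2
      apply Fin.ext
      rcases hkl.eq_or_eq_neg with h | h
      · rw [ZMod.natCast_eq_natCast_iff', Nat.mod_eq_of_lt (by omega),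
          Nat.mod_eq_of_lt (by omega)] at h
        exact h.symm
      · rw [eq_neg_iff_add_eq_zero, ← Nat.cast_add, ZMod.natCast_eq_zero_iff] at h
        obtain h | h := Nat.eq_zero_or_pos ((l : ℕ) + k)
        · omega
        · have := Nat.le_of_dvd h ‹_›
          omega
    · rintro ⟨q, hq⟩
      induction q using Quotient.inductionOn' with | h v => ?_
      obtain ⟨t, ht⟩ := ((neg_image_orbit_eq_iff v).1 hq).exists_of_neg
      refine ⟨⟨t.valMinAbs.natAbs, Nat.lt_succ_of_le t.natAbs_valMinAbs_le⟩,
        Subtype.ext (Quotient.sound' (mem_orbit_permTransGroup_iff.2 (ht.symm.trans ?_)))⟩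
      have hcast : ((t.valMinAbs.natAbs : ℕ) : ZMod n) = t ∨
          ((t.valMinAbs.natAbs : ℕ) : ZMod n) = -t := by
        rw [ZMod.natCast_natAbs_valMinAbs]
        exact ite_eq_or_eq _ _ _
      rcases hcast with h | h <;> simp only [h, neg_neg]
      · exact .refl _
      · exact .neg_param t
  rw [← Nat.card_eq_of_bijective f hf, Nat.card_fin]

/-- the number of orbits of `(ℤ/nℤ)³` under coordinate permutations and
simultaneous translations that are mapped to themselves by coordinatewise negation is
`n/2 + 1` if `n` is even, and `(n+1)/2` if `n` is odd. -/
theorem card_negation_invariant_orbits (n : ℕ) (hn : 1 ≤ n) :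
    (Even n →
      (Nat.card {q : MulAction.orbitRel.Quotient (permTransGroup n)
            (ZMod n × ZMod n × ZMod n) //
          (fun v => -v) '' q.orbit = q.orbit} : ℚ) = (1/2) * n + 1) ∧
    (Odd n →
      (Nat.card {q : MulAction.orbitRel.Quotient (permTransGroup n)
            (ZMod n × ZMod n × ZMod n) //
          (fun v => -v) '' q.orbit = q.orbit} : ℚ) = (n + 1) / 2) := by
  have : NeZero n := ⟨by omega⟩
  rw [card_neg_invariant_orbits_eq]
  constructor
  · rintro ⟨m, rfl⟩
    rw [← two_mul, Nat.mul_div_cancel_left m two_pos]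
    push_cast
    ring
  · rintro ⟨m, rfl⟩
    rw [show (2 * m + 1) / 2 = m by omega]
    push_cast
    ring
end
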